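/- Gasharov's bound: let k be a field, S = k[x_0,…,x_n] with the standard grading, F a free graded S-module all of whose generators have degree at most l, N a graded submodule of F, and M = F/N. Then for every pair of integers (p, d) with p ≥ 0 and d ≥ p + l + 1, one has H(M, d+1) ≤ H(M, d)^{⟨d − l − p⟩}. -/

import Mathlib

/-- The `d`-th Macaulay transform `a^{⟨d⟩}`: writing the (unique, greedy) `d`-th Macaulay
representation `a = C(k_d, d) + C(k_{d-1}, d-1) + ⋯ + C(k_δ, δ)` with
`k_d > k_{d-1} > ⋯ > k_δ ≥ δ ≥ 1`, it is `C(k_d+1, d+1) + ⋯ + C(k_δ+1, δ+1)`;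
by convention `0^{⟨d⟩} = 0`. -/
def macaulayTransform : ℕ → ℕ → ℕ
  | 0, _ => 0
  | _ + 1, 0 => 0
  | d + 1, a + 1 =>
    Nat.choose (Nat.findGreatest (fun k => Nat.choose k (d + 1) ≤ a + 1) (a + d + 2) + 1) (d + 2)
      + macaulayTransform d
          (a + 1 - Nat.choose (Nat.findGreatest (fun k => Nat.choose k (d + 1) ≤ a + 1) (a + d + 2)) (d + 1))

/-- The degree-`e` graded piece of `S = k[x_0, …, x_n]` (zero in negative degrees). -/
noncomputable def degPiece (K : Type) [Field K] (n : ℕ) (e : ℤ) :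
    Submodule K (MvPolynomial (Fin (n+1)) K) :=
  if 0 ≤ e then MvPolynomial.homogeneousSubmodule (Fin (n+1)) K e.toNat else ⊥

/-- The degree-`m` graded piece of the free module `F = S e_1 ⊕ ⋯ ⊕ S e_r` with
`deg e_i = f i`; its `i`-th coordinate is the degree-`(m - f i)` piece of `S`. -/
noncomputable def freeDegPiece (K : Type) [Field K] (n r : ℕ) (f : Fin r → ℤ) (m : ℤ) :
    Submodule K (Fin r → MvPolynomial (Fin (n+1)) K) :=
  Submodule.pi Set.univ (fun i => degPiece K n (m - f i))

/-- The Hilbert function `H(F/N, m) = dim_k F_m - dim_k (N ∩ F_m)` of the quotient of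
`F = S e_1 ⊕ ⋯ ⊕ S e_r` by a (graded) submodule `N`. -/
noncomputable def hilbFn (K : Type) [Field K] (n r : ℕ) (f : Fin r → ℤ)
    (N : Submodule (MvPolynomial (Fin (n+1)) K) (Fin r → MvPolynomial (Fin (n+1)) K))
    (m : ℤ) : ℕ :=
  Module.finrank K (freeDegPiece K n r f m) -
  Module.finrank K
    (N.restrictScalars K ⊓ freeDegPiece K n r f m :
      Submodule K (Fin r → MvPolynomial (Fin (n+1)) K))

/-! ### Macaulay representations -/

/-- The top index of the `t`-th Macaulay representation of `a`. -/
def macaulayTop (t a : ℕ) : ℕ := Nat.findGreatest (fun k => Nat.choose k t ≤ a) (a + t)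

/-- `IsMacaulayTop t a k` says that `k` is the top index of the `t`-th Macaulay
representation of `a`. -/
def IsMacaulayTop (t a k : ℕ) : Prop := k.choose t ≤ a ∧ a < (k + 1).choose t

lemma succ_le_choose_add (t a : ℕ) : a + 1 ≤ (a + (t + 1)).choose (t + 1) := by
  induction t with
  | zero => simp
  | succ t ih =>
    have h := Nat.choose_succ_succ (a + (t + 1)) (t + 1)
    rw [show a + (t + 1 + 1) = (a + (t + 1)).succ by omega]
    simp only [Nat.succ_eq_add_one] at h ⊢
    omega

lemma isMacaulayTop_macaulayTop (t a : ℕ) : IsMacaulayTop (t + 1) a (macaulayTop (t + 1) a) := by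
  unfold IsMacaulayTop macaulayTop
  refine ⟨?_, ?_⟩
  · exact Nat.findGreatest_spec (P := fun k => Nat.choose k (t + 1) ≤ a) (m := 0)
      (Nat.zero_le _) (by simp)
  · by_contra! h
    have hle := Nat.findGreatest_le (P := fun k => Nat.choose k (t + 1) ≤ a) (a + (t + 1))
    rcases hle.lt_or_eq with hlt | heq
    · exact Nat.findGreatest_is_greatest (P := fun k => Nat.choose k (t + 1) ≤ a)
        (Nat.lt_succ_self _) (Nat.succ_le_of_lt hlt) h
    · rw [heq] at h
      have h1 := succ_le_choose_add t a
      have h2 := Nat.choose_le_choose (t + 1) (Nat.le_succ (a + (t + 1)))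
      simp only [Nat.succ_eq_add_one] at h2
      omega

lemma IsMacaulayTop.le_of_le {t a b k m : ℕ} (ha : IsMacaulayTop t a k)
    (hb : IsMacaulayTop t b m) (hab : a ≤ b) : k ≤ m := by
  by_contra! h
  have := Nat.choose_le_choose t (Nat.succ_le_of_lt h)
  simp only [Nat.succ_eq_add_one] at this
  have := ha.1
  have := hb.2
  omega

lemma IsMacaulayTop.eq {t a k m : ℕ} (ha : IsMacaulayTop t a k) (hb : IsMacaulayTop t a m) :
    k = m :=
  le_antisymm (ha.le_of_le hb le_rfl) (hb.le_of_le ha le_rfl)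

lemma IsMacaulayTop.le_top {t a k : ℕ} (ha : IsMacaulayTop (t + 1) a k) : t ≤ k := by
  by_contra! h
  have := ha.2
  rw [Nat.choose_eq_zero_of_lt (by omega)] at this
  omega

lemma IsMacaulayTop.sub_lt {t a k : ℕ} (ha : IsMacaulayTop (t + 1) a k) :
    a - k.choose (t + 1) < k.choose t := by
  have h := Nat.choose_succ_succ k t
  simp only [Nat.succ_eq_add_one] at h
  have := ha.1
  have := ha.2
  omega

lemma isMacaulayTop_add {t k x : ℕ} (hx : x < k.choose t) :
    IsMacaulayTop (t + 1) (k.choose (t + 1) + x) k := by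
  have h := Nat.choose_succ_succ k t
  simp only [Nat.succ_eq_add_one] at h
  exact ⟨by omega, by omega⟩

lemma macaulayTransform_zero_right (t : ℕ) : macaulayTransform t 0 = 0 := by
  cases t <;> rfl

lemma macaulayTransform_of_isMacaulayTop {t a k : ℕ} (ha : IsMacaulayTop (t + 1) a k) :
    macaulayTransform (t + 1) a
      = (k + 1).choose (t + 2) + macaulayTransform t (a - k.choose (t + 1)) := by
  obtain rfl := (isMacaulayTop_macaulayTop t a).eq ha
  cases a with
  | zero =>
    have h := (isMacaulayTop_macaulayTop t 0).1
    have : macaulayTop (t + 1) 0 < t + 1 := by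
      by_contra! h'
      have := Nat.choose_pos h'
      omega
    rw [Nat.choose_eq_zero_of_lt (by omega), Nat.zero_sub, macaulayTransform_zero_right,
      macaulayTransform_zero_right]
  | succ a =>
    rw [macaulayTransform, macaulayTop, show a + 1 + (t + 1) = a + t + 2 by ring]

/-- The lower transform `a_{⟨t⟩} = C(k_t - 1, t) + C(k_{t-1} - 1, t - 1) + ⋯` appearing in
Green's hyperplane restriction theorem. -/
def greenTransform : ℕ → ℕ → ℕ
  | 0, _ => 0
  | t + 1, a => (macaulayTop (t + 1) a - 1).choose (t + 1)
      + greenTransform t (a - (macaulayTop (t + 1) a).choose (t + 1))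

lemma greenTransform_of_isMacaulayTop {t a k : ℕ} (ha : IsMacaulayTop (t + 1) a k) :
    greenTransform (t + 1) a
      = (k - 1).choose (t + 1) + greenTransform t (a - k.choose (t + 1)) := by
  obtain rfl := (isMacaulayTop_macaulayTop t a).eq ha
  rfl

lemma greenTransform_add {t k x : ℕ} (hx : x < k.choose t) :
    greenTransform (t + 1) (k.choose (t + 1) + x)
      = (k - 1).choose (t + 1) + greenTransform t x := by
  rw [greenTransform_of_isMacaulayTop (isMacaulayTop_add hx), Nat.add_sub_cancel_left]

lemma macaulayTransform_add {t k x : ℕ} (hx : x < k.choose t) :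
    macaulayTransform (t + 1) (k.choose (t + 1) + x)
      = (k + 1).choose (t + 2) + macaulayTransform t x := by
  rw [macaulayTransform_of_isMacaulayTop (isMacaulayTop_add hx), Nat.add_sub_cancel_left]

/-- Every `a` decomposes as its leading binomial plus a remainder. -/
lemma exists_eq_choose_add (t a : ℕ) :
    ∃ k x, t ≤ k ∧ x < k.choose t ∧ a = k.choose (t + 1) + x := by
  have h := isMacaulayTop_macaulayTop t a
  exact ⟨_, _, h.le_top, h.sub_lt, by have := h.1; omega⟩

lemma greenTransform_zero_right (t : ℕ) : greenTransform t 0 = 0 := by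
  induction t with
  | zero => rfl
  | succ t ih =>
    have := greenTransform_add (t := t) (k := t) (x := 0) (by simp)
    rw [Nat.choose_succ_self, Nat.choose_eq_zero_of_lt (by omega), ih] at this
    simpa using this

lemma choose_succ_of_pos {k : ℕ} (hk : 0 < k) (t : ℕ) :
    k.choose (t + 1) = (k - 1).choose t + (k - 1).choose (t + 1) := by
  obtain ⟨k, rfl⟩ : ∃ m, k = m + 1 := ⟨k - 1, by omega⟩
  exact Nat.choose_succ_succ k t

lemma greenTransform_one (a : ℕ) : greenTransform 1 a = a - 1 := by
  have := greenTransform_add (t := 0) (k := a) (x := 0) (by simp)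
  simpa [greenTransform] using this

lemma macaulayTransform_one (a : ℕ) : macaulayTransform 1 a = (a + 1).choose 2 := by
  have := macaulayTransform_add (t := 0) (k := a) (x := 0) (by simp)
  simpa [macaulayTransform] using this

lemma greenTransform_le_choose {t a k : ℕ} (h : a < (k + 1).choose t) :
    greenTransform t a ≤ k.choose t := by
  induction t generalizing a k with
  | zero => simp [greenTransform]
  | succ t ih =>
    obtain ⟨m, x, hm, hx, rfl⟩ := exists_eq_choose_add t a
    rw [greenTransform_add hx]
    have hmk : m ≤ k := by
      by_contra! h'
      have := Nat.choose_le_choose (t + 1) (Nat.succ_le_of_lt h')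
      simp only [Nat.succ_eq_add_one] at this
      omega
    refine le_trans ?_ (Nat.choose_le_choose (t + 1) hmk)
    rcases Nat.eq_zero_or_pos m with rfl | hm0
    · obtain rfl : t = 0 := by omega
      simp [greenTransform]
    · have := choose_succ_of_pos hm0 t
      have := ih (a := x) (k := m - 1) (by rwa [Nat.sub_add_cancel hm0])
      omega

lemma le_greenTransform_add_choose {t a k : ℕ} (h : a < (k + 1).choose (t + 1)) :
    a ≤ greenTransform (t + 1) a + k.choose t := by
  induction t generalizing a k with
  | zero => simp [greenTransform_one]; omega
  | succ t ih =>
    obtain ⟨m, x, hm, hx, rfl⟩ := exists_eq_choose_add (t + 1) a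
    rw [greenTransform_add hx]
    have hmk : m ≤ k := by
      by_contra! h'
      have := Nat.choose_le_choose (t + 1 + 1) (Nat.succ_le_of_lt h')
      simp only [Nat.succ_eq_add_one] at this
      omega
    have := Nat.choose_le_choose (t + 1) hmk
    have hm0 : 0 < m := by omega
    have := choose_succ_of_pos hm0 t
    have := choose_succ_of_pos hm0 (t + 1)
    have := ih (a := x) (k := m - 1) (by rwa [Nat.sub_add_cancel hm0])
    omega

lemma greenTransform_mono (t : ℕ) : Monotone (greenTransform t) := by
  induction t with
  | zero => intro a b _; rfl
  | succ t ih =>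
    intro a b hab
    have ha := isMacaulayTop_macaulayTop t a
    have hb := isMacaulayTop_macaulayTop t b
    rcases (ha.le_of_le hb hab).lt_or_eq with h | h
    · refine (greenTransform_le_choose ha.2).trans ?_
      rw [greenTransform_of_isMacaulayTop hb]
      have := Nat.choose_le_choose (t + 1) (Nat.le_sub_one_of_lt h)
      omega
    · rw [greenTransform_of_isMacaulayTop hb, ← h, greenTransform_of_isMacaulayTop ha]
      exact Nat.add_le_add_left (ih (Nat.sub_le_sub_right hab _)) _

lemma macaulayTransform_le_choose {t a k : ℕ} (h : a < (k + 1).choose t) :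
    macaulayTransform t a ≤ (k + 2).choose (t + 1) := by
  induction t generalizing a k with
  | zero => simp [macaulayTransform]
  | succ t ih =>
    obtain ⟨m, x, hm, hx, rfl⟩ := exists_eq_choose_add t a
    rw [macaulayTransform_add hx]
    have hmk : m ≤ k := by
      by_contra! h'
      have := Nat.choose_le_choose (t + 1) (Nat.succ_le_of_lt h')
      simp only [Nat.succ_eq_add_one] at this
      omega
    refine le_trans ?_ (Nat.choose_le_choose (t + 1 + 1) (Nat.add_le_add_right hmk 2))
    rcases Nat.eq_zero_or_pos m with rfl | hm0
    · obtain rfl : t = 0 := by omega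
      simp [macaulayTransform]
    · have h1 : (m + 2).choose (t + 2) = (m + 1).choose (t + 1) + (m + 1).choose (t + 2) :=
        Nat.choose_succ_succ (m + 1) (t + 1)
      have := ih (a := x) (k := m - 1) (by rwa [Nat.sub_add_cancel hm0])
      rw [show m - 1 + 2 = m + 1 by omega] at this
      rw [show t + 1 + 1 = t + 2 by ring, h1]
      omega

lemma macaulayTransform_mono (t : ℕ) : Monotone (macaulayTransform t) := by
  induction t with
  | zero => intro a b _; simp [macaulayTransform]
  | succ t ih =>
    intro a b hab
    have ha := isMacaulayTop_macaulayTop t a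
    have hb := isMacaulayTop_macaulayTop t b
    rcases (ha.le_of_le hb hab).lt_or_eq with h | h
    · refine (macaulayTransform_le_choose ha.2).trans ?_
      rw [macaulayTransform_of_isMacaulayTop hb]
      have := Nat.choose_le_choose (t + 1 + 1) (Nat.succ_le_succ (Nat.succ_le_of_lt h))
      simp only [Nat.succ_eq_add_one] at this
      exact this.trans (Nat.le_add_right _ _)
    · rw [macaulayTransform_of_isMacaulayTop hb, ← h, macaulayTransform_of_isMacaulayTop ha]
      exact Nat.add_le_add_left (ih (Nat.sub_le_sub_right hab _)) _

lemma macaulayTransform_choose (t k : ℕ) :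
    macaulayTransform (t + 1) (k.choose (t + 1)) = (k + 1).choose (t + 2) := by
  rcases Nat.lt_or_ge k t with h | h
  · rw [Nat.choose_eq_zero_of_lt (by omega), Nat.choose_eq_zero_of_lt (by omega),
      macaulayTransform_zero_right]
  · have := macaulayTransform_add (t := t) (k := k) (x := 0) (Nat.choose_pos h)
    simpa [macaulayTransform_zero_right] using this

lemma macaulayTransform_add_of_le {t k x : ℕ} (hx : x ≤ k.choose (t + 1)) :
    macaulayTransform (t + 2) (k.choose (t + 2) + x)
      = (k + 1).choose (t + 3) + macaulayTransform (t + 1) x := by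
  rcases hx.lt_or_eq with h | rfl
  · exact macaulayTransform_add h
  · have h1 := Nat.choose_succ_succ k (t + 1)
    have h2 := Nat.choose_succ_succ (k + 1) (t + 2)
    simp only [Nat.succ_eq_add_one] at h1 h2
    rw [macaulayTransform_choose, add_comm (k.choose _), ← h1, macaulayTransform_choose, h2]
    ring

lemma macaulayTransform_eq_add_greenTransform (t a : ℕ) :
    macaulayTransform (t + 1) a
      = a + macaulayTransform (t + 1) (greenTransform (t + 1) a) := by
  induction t generalizing a with
  | zero =>
    simp only [zero_add, greenTransform_one, macaulayTransform_one]
    cases a with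
    | zero => rfl
    | succ a =>
      have := Nat.choose_succ_succ (a + 1) 1
      simp only [Nat.succ_eq_add_one, Nat.choose_one_right] at this
      simpa using this
  | succ t ih =>
    obtain ⟨k, x, hk, hx, rfl⟩ := exists_eq_choose_add (t + 1) a
    have hk0 : 0 < k := by omega
    have hx' : x < (k - 1 + 1).choose (t + 1) := by rwa [Nat.sub_add_cancel hk0]
    rw [macaulayTransform_add hx, greenTransform_add hx,
      macaulayTransform_add_of_le (greenTransform_le_choose hx'), ih x, Nat.sub_add_cancel hk0]
    have := Nat.choose_succ_succ k (t + 2)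
    simp only [Nat.succ_eq_add_one] at this
    rw [show t + 1 + 2 = t + 2 + 1 by ring, this]
    ring

lemma greenTransform_lt {t a : ℕ} (ha : 0 < a) : greenTransform t a < a := by
  induction t generalizing a with
  | zero => exact ha
  | succ t ih =>
    obtain ⟨k, x, hk, hx, rfl⟩ := exists_eq_choose_add t a
    rw [greenTransform_add hx]
    rcases Nat.eq_zero_or_pos k with rfl | hk0
    · obtain rfl : t = 0 := by omega
      simp [greenTransform] at ha ⊢
      omega
    · have h := choose_succ_of_pos hk0 t
      rcases Nat.eq_zero_or_pos x with rfl | hx0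
      · rw [greenTransform_zero_right]
        rcases Nat.lt_or_ge (k - 1) t with h' | h'
        · rw [Nat.choose_eq_zero_of_lt (show k - 1 < t + 1 by omega)]
          omega
        · have := Nat.choose_pos h'
          omega
      · have := ih hx0
        omega

/-- The numerical heart of Green's theorem. -/
lemma le_greenTransform_of_le {t a c : ℕ} (hca : c ≤ a)
    (h : c ≤ greenTransform (t + 1) c + greenTransform t (a - c)) :
    c ≤ greenTransform (t + 1) a := by
  induction t generalizing a c with
  | zero =>
    rw [zero_add, greenTransform_one, show greenTransform 0 (a - c) = 0 from rfl] at h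
    omega
  | succ t ih =>
    obtain ⟨k, x, hk, hx, rfl⟩ := exists_eq_choose_add (t + 1) a
    obtain ⟨m, y, hm, hy, rfl⟩ := exists_eq_choose_add (t + 1) c
    have hk0 : 0 < k := by omega
    have hm0 : 0 < m := by omega
    have hmk : m ≤ k := (isMacaulayTop_add hy).le_of_le (isMacaulayTop_add hx) hca
    have hx' : x < (k - 1 + 1).choose (t + 1) := by rwa [Nat.sub_add_cancel hk0]
    rw [greenTransform_add hx]
    rw [greenTransform_add hy] at h
    have hm1 := choose_succ_of_pos hm0 (t + 1)
    have hgy : greenTransform (t + 1) y ≤ y := by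
      rcases Nat.eq_zero_or_pos y with rfl | hy0
      · rw [greenTransform_zero_right]
      · exact (greenTransform_lt hy0).le
    have hy0 : y ≤ greenTransform (t + 1) y → y = 0 := by
      intro h'
      by_contra h0
      have := greenTransform_lt (t := t + 1) (Nat.pos_of_ne_zero h0)
      omega
    rcases hmk.eq_or_lt with rfl | hlt
    · rw [Nat.add_sub_add_left] at h
      have h1 := greenTransform_mono (t + 1) (Nat.sub_le x y)
      have h2 := greenTransform_le_choose hx'
      have := hy0 (by omega)
      omega
    rcases (Nat.le_sub_one_of_lt hlt).lt_or_eq with hlt' | rfl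
    · have := (isMacaulayTop_add hy).2
      have := Nat.choose_le_choose (t + 1 + 1) (Nat.succ_le_of_lt hlt')
      simp only [Nat.succ_eq_add_one] at this
      omega
    · have hk1 := choose_succ_of_pos hk0 (t + 1)
      refine Nat.add_le_add_left ?_ _
      rcases Nat.lt_or_ge x y with hxy | hyx
      · have h1 : k.choose (t + 1 + 1) + x - ((k - 1).choose (t + 1 + 1) + y)
            < (k - 1 - 1 + 1).choose (t + 1) := by
          rw [Nat.sub_add_cancel hm0]
          omega
        have h2 := greenTransform_le_choose h1
        have := hy0 (by omega)
        omega
      · rw [show k.choose (t + 1 + 1) + x - ((k - 1).choose (t + 1 + 1) + y)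
            = (k - 1).choose (t + 1) + (x - y) by omega] at h
        rcases Nat.lt_or_ge (x - y) ((k - 1).choose t) with h' | h'
        · rw [greenTransform_add h'] at h
          exact ih hyx (by omega)
        · have := le_greenTransform_add_choose hx'
          omega

/-! ### Families of monomials -/

open Finset in
lemma sum_range_card_le_and_eq (T : Finset ℕ) :
    ∑ c ∈ range #T, c ≤ ∑ c ∈ T, c ∧ (∑ c ∈ T, c ≤ ∑ c ∈ range #T, c → T = range #T) := by
  induction T using Finset.induction_on_max with
  | empty => simp
  | insert a s has ih =>
    have ha : a ∉ s := fun h => lt_irrefl _ (has a h)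
    have hcard : #s ≤ a := by
      simpa using card_le_card (show s ⊆ range a from fun x hx => mem_range.2 (has x hx))
    rw [sum_insert ha, card_insert_of_notMem ha, sum_range_succ]
    refine ⟨by omega, fun h => ?_⟩
    obtain rfl : a = #s := by omega
    rw [range_add_one, ← ih.2 (by omega)]

open Finset in
lemma sum_range_card_lt {T : Finset ℕ} {c : ℕ} (h : c + 1 ∈ T) (h' : c ∉ T) :
    ∑ c ∈ range #T, c < ∑ c ∈ T, c := by
  by_contra! hle
  have hT := (sum_range_card_le_and_eq T).2 hle
  rw [hT, mem_range] at h h'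
  omega

/-- The total degree of a monomial in the variables of index at least `j`. -/
noncomputable def tailDegree (j : ℕ) : (ℕ →₀ ℕ) →+ ℕ :=
  Finsupp.weight (fun k => if j ≤ k then 1 else 0)

lemma tailDegree_single {j k : ℕ} (h : j ≤ k) (c : ℕ) :
    tailDegree j (Finsupp.single k c) = c := by
  simp [tailDegree, Finsupp.weight_single, h]

lemma exists_of_tailDegree_pos {j : ℕ} {m : ℕ →₀ ℕ} (h : 0 < tailDegree j m) :
    ∃ k, j ≤ k ∧ m k ≠ 0 := by
  by_contra! hk
  refine h.ne' ?_
  rw [tailDegree, Finsupp.weight_apply, Finsupp.sum]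
  refine Finset.sum_eq_zero fun k _ => ?_
  split_ifs with hjk
  · simp [hk k hjk]
  · simp

lemma tailDegree_succ {j : ℕ} {m : ℕ →₀ ℕ} (h : m j = 0) :
    tailDegree (j + 1) m = tailDegree j m := by
  simp only [tailDegree, Finsupp.weight_apply, Finsupp.sum]
  refine Finset.sum_congr rfl fun k hk => ?_
  have : k ≠ j := by rintro rfl; exact (Finsupp.mem_support_iff.1 hk) h
  simp only [show (j + 1 ≤ k) ↔ (j ≤ k) by omega]

lemma sub_single_add_single {m : ℕ →₀ ℕ} {k : ℕ} (h : m k ≠ 0) :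
    m - Finsupp.single k 1 + Finsupp.single k 1 = m := by
  refine tsub_add_cancel_of_le ?_
  rw [Finsupp.single_le_iff]
  omega

lemma sub_single_injOn {s : Set (ℕ →₀ ℕ)} {k : ℕ} (hs : ∀ m ∈ s, m k ≠ 0) :
    Set.InjOn (fun m : ℕ →₀ ℕ => m - Finsupp.single k 1) s := by
  intro a ha b hb hab
  rw [← sub_single_add_single (hs a ha), ← sub_single_add_single (hs b hb)]
  exact congrArg (· + Finsupp.single k 1) hab

/-- A family of monomials is shifted if it is stable under replacing one occurrence of a variable
by a variable of smaller index (all indices being at least `j`). -/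
def IsShifted (j : ℕ) (A : Finset (ℕ →₀ ℕ)) : Prop :=
  ∀ p q m, j ≤ p → p < q → m + Finsupp.single q 1 ∈ A → m + Finsupp.single p 1 ∈ A

/-- `A` contains every monomial obtained from `B` by dividing by a variable of index
at least `j`. -/
def ContainsShadow (j : ℕ) (A B : Finset (ℕ →₀ ℕ)) : Prop :=
  ∀ k m, j ≤ k → m + Finsupp.single k 1 ∈ B → m ∈ A

open Finset in
lemma IsShifted.filter {j : ℕ} {A : Finset (ℕ →₀ ℕ)} (hA : IsShifted j A) :
    IsShifted (j + 1) (A.filter (fun m => m j = 0)) := by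
  intro p q m hp hpq hm
  rw [mem_filter] at hm ⊢
  refine ⟨hA p q m (by omega) hpq hm.1, ?_⟩
  have := hm.2
  rw [Finsupp.add_apply, Finsupp.single_eq_of_ne (by omega)] at this ⊢
  exact this

open Finset in
lemma ContainsShadow.filter {j : ℕ} {A B : Finset (ℕ →₀ ℕ)} (h : ContainsShadow j A B) :
    ContainsShadow (j + 1) (A.filter (fun m => m j = 0)) (B.filter (fun m => m j = 0)) := by
  intro k m hk hm
  rw [mem_filter] at hm ⊢
  refine ⟨h k m (by omega) hm.1, ?_⟩
  have := hm.2
  rw [Finsupp.add_apply] at this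
  omega

open Finset in
lemma IsShifted.card_filter_lt {j : ℕ} {A : Finset (ℕ →₀ ℕ)} (hA : IsShifted j A)
    (hne : A.Nonempty) (hdeg : ∀ m ∈ A, 0 < tailDegree j m) :
    #(A.filter (fun m => m j = 0)) < #A := by
  obtain ⟨m, hm⟩ := hne
  obtain ⟨k, hjk, hk⟩ := exists_of_tailDegree_pos (hdeg m hm)
  have key : ∃ x ∈ A, x j ≠ 0 := by
    rcases hjk.eq_or_lt with rfl | hlt
    · exact ⟨m, hm, hk⟩
    · rw [← sub_single_add_single hk] at hm
      exact ⟨_, hA j k _ le_rfl hlt hm, by simp⟩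
  obtain ⟨x, hx, hxj⟩ := key
  exact card_lt_card (filter_ssubset.2 ⟨x, hx, hxj⟩)

open Finset in
/-- Green's restriction theorem for shifted families of monomials. -/
lemma IsShifted.card_filter_le {t j : ℕ} {A : Finset (ℕ →₀ ℕ)} (hA : IsShifted j A)
    (hdeg : ∀ m ∈ A, t + 1 ≤ tailDegree j m) :
    #(A.filter (fun m => m j = 0)) ≤ greenTransform (t + 1) #A := by
  induction t generalizing j A with
  | zero =>
    rw [zero_add, greenTransform_one]
    rcases A.eq_empty_or_nonempty with rfl | hne
    · simp
    · exact Nat.le_sub_one_of_lt (hA.card_filter_lt hne fun m hm => hdeg m hm)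
  | succ t iht =>
    induction hn : #A using Nat.strong_induction_on generalizing j A with
    | _ a ih =>
    subst hn
    rcases A.eq_empty_or_nonempty with rfl | hne
    · simp
    have hlt := hA.card_filter_lt hne fun m hm => (Nat.succ_pos _).trans_le (hdeg m hm)
    set A₁ := A.filter (fun m => m j = 0)
    set A₀ := (A.filter (fun m => ¬ m j = 0)).image (fun m => m - Finsupp.single j 1) with hA₀
    have hcard : #A₀ = #A - #A₁ := by
      rw [hA₀, card_image_of_injOn (sub_single_injOn (by simp)),
        ← card_filter_add_card_filter_not (s := A) (fun m => m j = 0), Nat.add_sub_cancel_left]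
    have hmem : ∀ m, m ∈ A₀ ↔ m + Finsupp.single j 1 ∈ A := by
      intro m
      simp only [hA₀, mem_image, mem_filter]
      constructor
      · rintro ⟨x, ⟨hx, hxj⟩, rfl⟩
        rwa [sub_single_add_single hxj]
      · intro h
        exact ⟨_, ⟨h, by simp⟩, by simp⟩
    have h1 : #(A₁.filter (fun m => m (j + 1) = 0)) ≤ greenTransform (t + 1 + 1) #A₁ :=
      ih #A₁ hlt hA.filter (fun m hm => by
        rw [tailDegree_succ (mem_filter.1 hm).2]
        exact hdeg m (mem_filter.1 hm).1) rfl
    have h0 : #(A₀.filter (fun m => m j = 0)) ≤ greenTransform (t + 1) #A₀ := by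
      refine iht (fun p q m hp hpq hm => ?_) (fun m hm => ?_)
      · rw [hmem, add_right_comm] at hm ⊢
        exact hA p q _ hp hpq hm
      · have := hdeg _ ((hmem m).1 hm)
        rw [map_add, tailDegree_single le_rfl] at this
        omega
    have hinj : #(A₁.filter (fun m => ¬ m (j + 1) = 0)) ≤ #(A₀.filter (fun m => m j = 0)) := by
      refine card_le_card_of_injOn (fun m => m - Finsupp.single (j + 1) 1) (fun m hm => ?_)
        (sub_single_injOn (by simp))
      obtain ⟨hm, hmj⟩ := mem_filter.1 hm
      obtain ⟨hm, hm0⟩ := mem_filter.1 hm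
      rw [← sub_single_add_single hmj] at hm
      refine mem_filter.2 ⟨(hmem _).2 (hA j (j + 1) _ le_rfl (Nat.lt_succ_self j) hm), ?_⟩
      simp [hm0]
    have hsplit := card_filter_add_card_filter_not (s := A₁) (fun m => m (j + 1) = 0)
    refine le_greenTransform_of_le hlt.le ?_
    rw [← hcard]
    omega

open Finset in
/-- Macaulay's bound for shifted families of monomials. -/
lemma IsShifted.card_le_macaulayTransform {t j : ℕ} {A B : Finset (ℕ →₀ ℕ)} (hA : IsShifted j A)
    (hAB : ContainsShadow j A B) (hdegA : ∀ m ∈ A, t + 1 ≤ tailDegree j m)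
    (hdegB : ∀ m ∈ B, 0 < tailDegree j m) :
    #B ≤ macaulayTransform (t + 1) #A := by
  induction hn : #A using Nat.strong_induction_on generalizing j A B with
  | _ a ih =>
  subst hn
  rcases A.eq_empty_or_nonempty with rfl | hne
  · suffices B = ∅ by simp [this]
    refine eq_empty_of_forall_notMem fun m hm => ?_
    obtain ⟨k, hjk, hk⟩ := exists_of_tailDegree_pos (hdegB m hm)
    rw [← sub_single_add_single hk] at hm
    exact notMem_empty _ (hAB k _ hjk hm)
  have hlt := hA.card_filter_lt hne fun m hm => (Nat.succ_pos _).trans_le (hdegA m hm)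
  have h1 := ih _ hlt hA.filter hAB.filter
    (fun m hm => by
      rw [tailDegree_succ (mem_filter.1 hm).2]
      exact hdegA m (mem_filter.1 hm).1)
    (fun m hm => by
      rw [tailDegree_succ (mem_filter.1 hm).2]
      exact hdegB m (mem_filter.1 hm).1) rfl
  have h0 : #(B.filter (fun m => ¬ m j = 0)) ≤ #A := by
    refine card_le_card_of_injOn (fun m => m - Finsupp.single j 1) (fun m hm => ?_)
      (sub_single_injOn (by simp))
    obtain ⟨hm, hmj⟩ := mem_filter.1 hm
    rw [← sub_single_add_single hmj] at hm
    exact hAB j _ le_rfl hm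
  have h2 := macaulayTransform_mono (t + 1) (hA.card_filter_le hdegA)
  have hsplit := card_filter_add_card_filter_not (s := B) (fun m => m j = 0)
  rw [macaulayTransform_eq_add_greenTransform]
  omega

/-! ### Compression with respect to two variables -/

section Compression

variable {p q : ℕ}

/-- The monomial obtained from `u` by replacing `x_p ^ c` by `x_q ^ c`. -/
noncomputable def moveVar (p q : ℕ) (u : ℕ →₀ ℕ) (c : ℕ) : ℕ →₀ ℕ :=
  u - Finsupp.single p c + Finsupp.single q c

/-- The monomial obtained from `m` by replacing every `x_q` by `x_p`. -/
noncomputable def mergeVar (p q : ℕ) (m : ℕ →₀ ℕ) : ℕ →₀ ℕ := moveVar q p m (m q)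

lemma moveVar_apply (p q : ℕ) (u : ℕ →₀ ℕ) (c k : ℕ) :
    moveVar p q u c k = u k - (if p = k then c else 0) + (if q = k then c else 0) := by
  simp only [moveVar, Finsupp.add_apply, Finsupp.tsub_apply, Finsupp.single_apply]

lemma mergeVar_apply (p q : ℕ) (m : ℕ →₀ ℕ) (k : ℕ) :
    mergeVar p q m k = m k - (if q = k then m q else 0) + (if p = k then m q else 0) :=
  moveVar_apply ..

lemma mergeVar_apply_right (hpq : p ≠ q) (m : ℕ →₀ ℕ) : mergeVar p q m q = 0 := by
  simp [mergeVar_apply, hpq]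

lemma mergeVar_apply_left (hpq : p ≠ q) (m : ℕ →₀ ℕ) : mergeVar p q m p = m p + m q := by
  simp [mergeVar_apply, hpq.symm]

lemma moveVar_apply_right (hpq : p ≠ q) {u : ℕ →₀ ℕ} (hu : u q = 0) (c : ℕ) :
    moveVar p q u c q = c := by
  simp [moveVar_apply, hpq, hu]

lemma mergeVar_moveVar (hpq : p ≠ q) {u : ℕ →₀ ℕ} (hu : u q = 0) {c : ℕ} (hc : c ≤ u p) :
    mergeVar p q (moveVar p q u c) = u := by
  ext k
  rw [mergeVar_apply, moveVar_apply_right hpq hu, moveVar_apply]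
  split_ifs <;> subst_vars <;> omega

lemma moveVar_mergeVar (hpq : p ≠ q) (m : ℕ →₀ ℕ) :
    moveVar p q (mergeVar p q m) (m q) = m := by
  ext k
  rw [moveVar_apply, mergeVar_apply]
  split_ifs <;> subst_vars <;> omega

lemma mergeVar_add_single_right (hpq : p ≠ q) (m : ℕ →₀ ℕ) :
    mergeVar p q (m + Finsupp.single q 1) = mergeVar p q m + Finsupp.single p 1 := by
  ext k
  simp only [mergeVar_apply, Finsupp.add_apply, Finsupp.single_apply]
  split_ifs <;> subst_vars <;> omega

lemma mergeVar_add_single (hpq : p ≠ q) {k : ℕ} (hk : k ≠ q) (m : ℕ →₀ ℕ) :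
    mergeVar p q (m + Finsupp.single k 1) = mergeVar p q m + Finsupp.single k 1 := by
  ext i
  simp only [mergeVar_apply, Finsupp.add_apply, Finsupp.single_apply]
  split_ifs <;> subst_vars <;> omega

lemma moveVar_add_single {k c : ℕ} {u : ℕ →₀ ℕ} (hc : c ≤ u p) :
    moveVar p q (u + Finsupp.single k 1) c = moveVar p q u c + Finsupp.single k 1 := by
  ext i
  simp only [moveVar_apply, Finsupp.add_apply, Finsupp.single_apply]
  split_ifs <;> subst_vars <;> omega

lemma moveVar_add_single_succ {c : ℕ} {u : ℕ →₀ ℕ} :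
    moveVar p q (u + Finsupp.single p 1) (c + 1) = moveVar p q u c + Finsupp.single q 1 := by
  ext i
  simp only [moveVar_apply, Finsupp.add_apply, Finsupp.single_apply]
  split_ifs <;> subst_vars <;> omega

lemma weight_moveVar (w : ℕ → ℕ) {u : ℕ →₀ ℕ} {c : ℕ} (hc : c ≤ u p) :
    Finsupp.weight w (moveVar p q u c) + c * w p = Finsupp.weight w u + c * w q := by
  have h : u - Finsupp.single p c + Finsupp.single p c = u :=
    tsub_add_cancel_of_le (Finsupp.single_le_iff.2 hc)
  conv_rhs => rw [← h]
  simp only [moveVar, map_add, Finsupp.weight_single, smul_eq_mul]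
  ring

lemma tailDegree_moveVar {j : ℕ} (hp : j ≤ p) (hq : j ≤ q) {u : ℕ →₀ ℕ} {c : ℕ} (hc : c ≤ u p) :
    tailDegree j (moveVar p q u c) = tailDegree j u := by
  have := weight_moveVar (p := p) (q := q) (fun k => if j ≤ k then 1 else 0) hc
  simpa [hp, hq, tailDegree] using this

open Finset

/-- The exponents of `x_q` of the members of `A` lying over `u` under `mergeVar p q`. -/
noncomputable def fiberExps (p q : ℕ) (A : Finset (ℕ →₀ ℕ)) (u : ℕ →₀ ℕ) : Finset ℕ :=
  (range (u p + 1)).filter (fun c => moveVar p q u c ∈ A)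

/-- The compression of a family of monomials with respect to the variables `x_p` and `x_q`:
each fibre of `mergeVar p q` is replaced by an initial segment of the same size. -/
noncomputable def compress (p q : ℕ) (A : Finset (ℕ →₀ ℕ)) : Finset (ℕ →₀ ℕ) :=
  (A.image (mergeVar p q)).biUnion fun u => (range #(fiberExps p q A u)).image (moveVar p q u)

lemma mem_fiberExps {A : Finset (ℕ →₀ ℕ)} {u : ℕ →₀ ℕ} {c : ℕ} :
    c ∈ fiberExps p q A u ↔ c ≤ u p ∧ moveVar p q u c ∈ A := by
  simp [fiberExps]

lemma card_fiberExps_le (A : Finset (ℕ →₀ ℕ)) (u : ℕ →₀ ℕ) : #(fiberExps p q A u) ≤ u p + 1 :=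
  (card_filter_le _ _).trans_eq (card_range _)

lemma mem_compress (hpq : p ≠ q) {A : Finset (ℕ →₀ ℕ)} {x : ℕ →₀ ℕ} :
    x ∈ compress p q A ↔ x q < #(fiberExps p q A (mergeVar p q x)) := by
  simp only [compress, mem_biUnion, mem_image, mem_range]
  constructor
  · rintro ⟨_, ⟨m, hm, rfl⟩, c, hc, rfl⟩
    have := card_fiberExps_le (p := p) (q := q) A (mergeVar p q m)
    rwa [mergeVar_moveVar hpq (mergeVar_apply_right hpq m) (by omega),
      moveVar_apply_right hpq (mergeVar_apply_right hpq m)]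
  · intro h
    obtain ⟨c, hc⟩ := card_pos.1 ((Nat.zero_le _).trans_lt h)
    rw [mem_fiberExps] at hc
    exact ⟨_, ⟨_, hc.2, mergeVar_moveVar hpq (mergeVar_apply_right hpq x) hc.1⟩, _, h,
      moveVar_mergeVar hpq x⟩

lemma sum_biUnion_moveVar (hpq : p ≠ q) {I : Finset (ℕ →₀ ℕ)} (hI : ∀ u ∈ I, u q = 0)
    {T : (ℕ →₀ ℕ) → Finset ℕ} (hT : ∀ u ∈ I, ∀ c ∈ T u, c ≤ u p) (f : (ℕ →₀ ℕ) → ℕ) :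
    ∑ x ∈ I.biUnion (fun u => (T u).image (moveVar p q u)), f x
      = ∑ u ∈ I, ∑ c ∈ T u, f (moveVar p q u c) := by
  rw [sum_biUnion]
  · refine sum_congr rfl fun u hu => sum_image fun a _ b _ hab => ?_
    rw [← moveVar_apply_right hpq (hI u hu) a, ← moveVar_apply_right hpq (hI u hu) b]
    exact congrArg (fun m => m q) hab
  · intro u hu v hv huv
    refine disjoint_left.2 fun x hx hx' => huv ?_
    obtain ⟨a, ha, rfl⟩ := mem_image.1 hx
    obtain ⟨b, hb, hab⟩ := mem_image.1 hx'
    rw [← mergeVar_moveVar hpq (hI u hu) (hT u hu a ha), ← hab,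
      mergeVar_moveVar hpq (hI v hv) (hT v hv b hb)]

lemma eq_biUnion_fiberExps (hpq : p ≠ q) (A : Finset (ℕ →₀ ℕ)) :
    (A.image (mergeVar p q)).biUnion (fun u => (fiberExps p q A u).image (moveVar p q u)) = A := by
  ext x
  simp only [mem_biUnion, mem_image, mem_fiberExps]
  constructor
  · rintro ⟨_, _, c, hc, rfl⟩
    exact hc.2
  · intro hx
    refine ⟨_, ⟨x, hx, rfl⟩, x q, ⟨?_, ?_⟩, moveVar_mergeVar hpq x⟩
    · rw [mergeVar_apply_left hpq]
      omega
    · rwa [moveVar_mergeVar hpq]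

lemma sum_eq_sum_fiberExps (hpq : p ≠ q) (A : Finset (ℕ →₀ ℕ)) (f : (ℕ →₀ ℕ) → ℕ) :
    ∑ x ∈ A, f x
      = ∑ u ∈ A.image (mergeVar p q), ∑ c ∈ fiberExps p q A u, f (moveVar p q u c) := by
  conv_lhs => rw [← eq_biUnion_fiberExps hpq A]
  refine sum_biUnion_moveVar hpq (fun u hu => ?_) (fun u _ c hc => (mem_fiberExps.1 hc).1) f
  obtain ⟨m, _, rfl⟩ := mem_image.1 hu
  exact mergeVar_apply_right hpq m

lemma sum_compress (hpq : p ≠ q) (A : Finset (ℕ →₀ ℕ)) (f : (ℕ →₀ ℕ) → ℕ) :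
    ∑ x ∈ compress p q A, f x
      = ∑ u ∈ A.image (mergeVar p q), ∑ c ∈ range #(fiberExps p q A u), f (moveVar p q u c) := by
  refine sum_biUnion_moveVar hpq (fun u hu => ?_) (fun u _ c hc => ?_) f
  · obtain ⟨m, _, rfl⟩ := mem_image.1 hu
    exact mergeVar_apply_right hpq m
  · have := card_fiberExps_le (p := p) (q := q) A u
    have := mem_range.1 hc
    omega

lemma card_compress (hpq : p ≠ q) (A : Finset (ℕ →₀ ℕ)) : #(compress p q A) = #A := by
  have h1 := sum_compress hpq A (fun _ => 1)
  have h2 := sum_eq_sum_fiberExps hpq A (fun _ => 1)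
  simp only [sum_const, smul_eq_mul, mul_one, card_range] at h1 h2
  rw [h1, h2]

lemma exists_mem_of_mem_compress (hpq : p ≠ q) {A : Finset (ℕ →₀ ℕ)} {j : ℕ} (hp : j ≤ p)
    (hq : j ≤ q) {x : ℕ →₀ ℕ} (hx : x ∈ compress p q A) :
    ∃ y ∈ A, tailDegree j y = tailDegree j x := by
  rw [mem_compress hpq] at hx
  obtain ⟨c, hc⟩ := card_pos.1 ((Nat.zero_le _).trans_lt hx)
  rw [mem_fiberExps] at hc
  refine ⟨_, hc.2, ?_⟩
  rw [tailDegree_moveVar hp hq hc.1]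
  conv_rhs => rw [← moveVar_mergeVar hpq x]
  rw [tailDegree_moveVar hp hq]
  rw [mergeVar_apply_left hpq]
  omega

/-- The sum over a family of monomials of the index-weighted degrees. -/
noncomputable def indexWeight (A : Finset (ℕ →₀ ℕ)) : ℕ :=
  ∑ m ∈ A, Finsupp.weight (fun k => k) m

lemma sum_weight_moveVar (hpq : p < q) {u : ℕ →₀ ℕ} {T : Finset ℕ} (hT : ∀ c ∈ T, c ≤ u p) :
    ∑ c ∈ T, Finsupp.weight (fun k => k) (moveVar p q u c)
      = #T * Finsupp.weight (fun k => k) u + (q - p) * ∑ c ∈ T, c := by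
  rw [mul_sum, card_eq_sum_ones, sum_mul, ← sum_add_distrib]
  refine sum_congr rfl fun c hc => ?_
  have h : Finsupp.weight (fun k => k) (moveVar p q u c) + c * p
      = Finsupp.weight (fun k => k) u + c * q := weight_moveVar (fun k => k) (hT c hc)
  obtain ⟨e, rfl⟩ := Nat.exists_eq_add_of_lt hpq
  rw [show p + e + 1 - p = e + 1 by omega]
  linarith

lemma indexWeight_compress_lt (hpq : p < q) {A : Finset (ℕ →₀ ℕ)} {m : ℕ →₀ ℕ}
    (hm : m + Finsupp.single q 1 ∈ A) (hm' : m + Finsupp.single p 1 ∉ A) :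
    indexWeight (compress p q A) < indexWeight A := by
  rw [indexWeight, indexWeight, sum_compress hpq.ne, sum_eq_sum_fiberExps hpq.ne A]
  have h1 : ∀ u, ∑ c ∈ range #(fiberExps p q A u), Finsupp.weight (fun k => k) (moveVar p q u c)
      = #(fiberExps p q A u) * Finsupp.weight (fun k => k) u
        + (q - p) * ∑ c ∈ range #(fiberExps p q A u), c := fun u => by
    rw [sum_weight_moveVar hpq, card_range]
    intro c hc
    have := card_fiberExps_le (p := p) (q := q) A u
    have := mem_range.1 hc
    omega
  have h2 : ∀ u, ∑ c ∈ fiberExps p q A u, Finsupp.weight (fun k => k) (moveVar p q u c)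
      = #(fiberExps p q A u) * Finsupp.weight (fun k => k) u
        + (q - p) * ∑ c ∈ fiberExps p q A u, c := fun u =>
    sum_weight_moveVar hpq fun c hc => (mem_fiberExps.1 hc).1
  simp only [h1, h2]
  refine sum_lt_sum (fun u _ => ?_) ⟨_, mem_image_of_mem (mergeVar p q) hm, ?_⟩
  · exact Nat.add_le_add_left (Nat.mul_le_mul_left _ (sum_range_card_le_and_eq _).1) _
  · refine Nat.add_lt_add_left (Nat.mul_lt_mul_of_pos_left ?_ (Nat.sub_pos_of_lt hpq)) _
    have hle : m q ≤ mergeVar p q m p := by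
      rw [mergeVar_apply_left hpq.ne]
      omega
    rw [mergeVar_add_single_right hpq.ne]
    refine sum_range_card_lt (c := m q) ?_ ?_
    · rw [mem_fiberExps, moveVar_add_single_succ, moveVar_mergeVar hpq.ne]
      exact ⟨by simpa using hle, hm⟩
    · rw [mem_fiberExps, moveVar_add_single hle, moveVar_mergeVar hpq.ne]
      exact fun h => hm' h.2

lemma lt_card_fiberExps {j c : ℕ} {A B : Finset (ℕ →₀ ℕ)} (hAB : ContainsShadow j A B)
    (hp : j ≤ p) (hq : j ≤ q) {u : ℕ →₀ ℕ} (hcu : c ≤ u p)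
    (hc : c < #(fiberExps p q B (u + Finsupp.single p 1))) :
    c < #(fiberExps p q A u) := by
  have hle : ∀ b ≤ u p, b ∈ fiberExps p q B (u + Finsupp.single p 1) →
      b ∈ fiberExps p q A u := fun b hb h => by
    rw [mem_fiberExps, moveVar_add_single hb] at h
    exact mem_fiberExps.2 ⟨hb, hAB p _ hp h.2⟩
  have hsucc : ∀ b, b + 1 ∈ fiberExps p q B (u + Finsupp.single p 1) →
      b ∈ fiberExps p q A u := fun b h => by
    rw [mem_fiberExps, moveVar_add_single_succ] at h
    have h1 := h.1
    simp only [Finsupp.add_apply, Finsupp.single_eq_same] at h1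
    exact mem_fiberExps.2 ⟨by omega, hAB q _ hq h.2⟩
  by_cases hall : ∀ b ≤ u p, b ∈ fiberExps p q A u
  · have : #(range (u p + 1)) ≤ #(fiberExps p q A u) :=
      card_le_card fun b hb => hall b (Nat.lt_succ_iff.1 (mem_range.1 hb))
    rw [card_range] at this
    omega
  · push Not at hall
    obtain ⟨g, hg, hgA⟩ := hall
    refine hc.trans_le (card_le_card_of_injOn (fun b => if b ≤ g then b else b - 1) ?_ ?_)
    · intro b hb
      by_cases hbg : b ≤ g
      · simpa [hbg] using hle b (by omega) hb
      · have := hsucc (b - 1) (by rwa [Nat.sub_add_cancel (by omega)])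
        simpa [hbg] using this
    · intro a ha b hb hab
      have ha' : a ≠ g := by rintro rfl; exact hgA (hle a hg ha)
      have hb' : b ≠ g := by rintro rfl; exact hgA (hle b hg hb)
      simp only at hab
      split_ifs at hab <;> omega

lemma ContainsShadow.compress {j : ℕ} {A B : Finset (ℕ →₀ ℕ)} (hAB : ContainsShadow j A B)
    (hp : j ≤ p) (hq : j ≤ q) (hpq : p ≠ q) :
    ContainsShadow j (compress p q A) (compress p q B) := by
  intro k m hk hm
  rw [mem_compress hpq] at hm ⊢
  have hle : m q ≤ mergeVar p q m p := by
    rw [mergeVar_apply_left hpq]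
    omega
  rw [Finsupp.add_apply] at hm
  by_cases hkq : k = q
  · subst hkq
    rw [mergeVar_add_single_right hpq] at hm
    exact lt_card_fiberExps hAB hp hq hle (by omega)
  rw [mergeVar_add_single hpq hkq] at hm
  by_cases hkp : k = p
  · subst hkp
    exact lt_card_fiberExps hAB hp hq hle (by omega)
  · rw [Finsupp.single_eq_of_ne (Ne.symm hkq), add_zero] at hm
    refine hm.trans_le (card_le_card fun c hc => ?_)
    have hc' := (mem_fiberExps.1 hc)
    have hcu : c ≤ mergeVar p q m p := by simpa [hkp] using hc'.1
    rw [moveVar_add_single hcu] at hc'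
    exact mem_fiberExps.2 ⟨hcu, hAB k _ hk hc'.2⟩

end Compression

open Finset in
/-- Macaulay's bound for arbitrary families of monomials. -/
theorem card_le_macaulayTransform {t j : ℕ} {A B : Finset (ℕ →₀ ℕ)} (hAB : ContainsShadow j A B)
    (hdegA : ∀ m ∈ A, t + 1 ≤ tailDegree j m) (hdegB : ∀ m ∈ B, 0 < tailDegree j m) :
    #B ≤ macaulayTransform (t + 1) #A := by
  induction hn : indexWeight A using Nat.strong_induction_on generalizing A B with
  | _ w ih =>
  subst hn
  by_cases hA : IsShifted j A
  · exact hA.card_le_macaulayTransform hAB hdegA hdegB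
  · simp only [IsShifted, not_forall] at hA
    obtain ⟨p, q, m, hp, hpq, hm, hm'⟩ := hA
    have hq : j ≤ q := hp.trans hpq.le
    rw [← card_compress hpq.ne A, ← card_compress hpq.ne B]
    refine ih _ (indexWeight_compress_lt hpq hm hm') (hAB.compress hp hq hpq.ne)
      (fun x hx => ?_) (fun x hx => ?_) rfl
    · obtain ⟨y, hy, hyx⟩ := exists_mem_of_mem_compress hpq.ne hp hq hx
      exact hyx ▸ hdegA y hy
    · obtain ⟨y, hy, hyx⟩ := exists_mem_of_mem_compress hpq.ne hp hq hx
      exact hyx ▸ hdegB y hy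

/-! ### Leading monomials -/

section Leading

variable {K E J : Type*} [Field K] [AddCommGroup E] [Module K E] [LinearOrder J]

open Finset

open scoped Classical in
/-- The indices in `D` that occur as the largest index of a nonzero coordinate of some member
of `V`. -/
noncomputable def leadIndices (coef : J → E →ₗ[K] K) (D : Finset J) (V : Submodule K E) :
    Finset J :=
  D.filter fun j => ∃ v ∈ V, coef j v ≠ 0 ∧ ∀ i, j < i → coef i v = 0

lemma mem_leadIndices {coef : J → E →ₗ[K] K} {D : Finset J} {V : Submodule K E} {j : J} :
    j ∈ leadIndices coef D V ↔ j ∈ D ∧ ∃ v ∈ V, coef j v ≠ 0 ∧ ∀ i, j < i → coef i v = 0 := by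
  simp [leadIndices]

lemma leadIndices_subset (coef : J → E →ₗ[K] K) (D : Finset J) (V : Submodule K E) :
    leadIndices coef D V ⊆ D :=
  fun _ hj => (mem_leadIndices.1 hj).1

lemma card_leadIndices_eq_finrank (coef : J → E →ₗ[K] K) (D : Finset J) (V : Submodule K E)
    (hD : ∀ v ∈ V, ∀ j, coef j v ≠ 0 → j ∈ D) (hV : ∀ v ∈ V, (∀ j, coef j v = 0) → v = 0) :
    #(leadIndices coef D V) = Module.finrank K V := by
  classical
  set L := leadIndices coef D V
  let φ : V →ₗ[K] (L → K) := LinearMap.pi fun j => (coef j).comp V.subtype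
  have hφ : Function.Injective φ := by
    rw [← LinearMap.ker_eq_bot, LinearMap.ker_eq_bot']
    rintro ⟨v, hv⟩ h0
    by_contra hne
    have hne' : (D.filter fun j => coef j v ≠ 0).Nonempty := by
      by_contra hemp
      rw [not_nonempty_iff_eq_empty, filter_eq_empty_iff] at hemp
      refine hne (Subtype.ext (hV v hv fun j => ?_))
      by_contra hj
      exact hemp (hD v hv j hj) hj
    obtain ⟨hmD, hm0⟩ := mem_filter.1 (max'_mem _ hne')
    refine hm0 (congrFun h0 ⟨_, mem_leadIndices.2 ⟨hmD, v, hv, hm0, fun i hi => ?_⟩⟩)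
    by_contra hi0
    exact hi.not_ge (le_max' _ i (mem_filter.2 ⟨hD v hv i hi0, hi0⟩))
  have hfin : FiniteDimensional K V := FiniteDimensional.of_injective φ hφ
  refine le_antisymm ?_ ?_
  · choose w hwV hw0 hw using fun j : L => (mem_leadIndices.1 j.2).2
    have hli : LinearIndependent K (fun j : L => (⟨w j, hwV j⟩ : V)) := by
      rw [Fintype.linearIndependent_iff]
      intro g hg
      by_contra! hex
      have hne : (univ.filter fun j : L => g j ≠ 0).Nonempty := by
        obtain ⟨j, hj⟩ := hex
        exact ⟨j, by simpa using hj⟩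
      set m := max' _ hne
      have hgm : g m ≠ 0 := (mem_filter.1 (max'_mem _ hne)).2
      have h1 := congrArg (fun v : V => coef m v) hg
      simp only [Submodule.coe_sum, Submodule.coe_smul, map_sum, map_smul, smul_eq_mul,
        ZeroMemClass.coe_zero, map_zero] at h1
      rw [sum_eq_single m] at h1
      · exact (mul_ne_zero hgm (hw0 m)) h1
      · intro j _ hjm
        by_cases hj : g j = 0
        · rw [hj, zero_mul]
        · have : j ≤ m := le_max' _ j (by simpa using hj)
          rw [hw j m (lt_of_le_of_ne this (Subtype.coe_ne_coe.2 hjm)), mul_zero]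
      · simp
    simpa using hli.fintype_card_le_finrank
  · simpa using LinearMap.finrank_le_finrank_of_injective hφ

end Leading

/-! ### Monomials of a free module -/

section FreeModule

variable {K : Type} [Field K] {n r : ℕ}

/-- Indices for the monomials `x^m e_i` of the free module, ordered by position over term. -/
abbrev MonIndex (n r : ℕ) : Type := Fin r ×ₗ Lex (Fin (n + 1) →₀ ℕ)

/-- The index of the monomial `x^m e_i`. -/
def monIndex (i : Fin r) (m : Fin (n + 1) →₀ ℕ) : MonIndex n r := toLex (i, toLex m)

lemma exists_eq_monIndex (j : MonIndex n r) : ∃ i m, j = monIndex i m := ⟨_, _, rfl⟩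

lemma monIndex_lt_of_add_lt {i i' : Fin r} {m m' u : Fin (n + 1) →₀ ℕ}
    (h : monIndex i (m + u) < monIndex i' (m' + u)) : monIndex i m < monIndex i' m' := by
  simp only [monIndex, Prod.Lex.toLex_lt_toLex] at h ⊢
  exact h.imp_right fun h => ⟨h.1, lt_of_add_lt_add_right (a := toLex u) h.2⟩

/-- The coefficient of the monomial with a given index. -/
noncomputable def monCoeff (j : MonIndex n r) :
    (Fin r → MvPolynomial (Fin (n + 1)) K) →ₗ[K] K :=
  (MvPolynomial.lcoeff K (ofLex (ofLex j).2)).comp (LinearMap.proj (ofLex j).1)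

lemma monCoeff_monIndex (i : Fin r) (m : Fin (n + 1) →₀ ℕ)
    (v : Fin r → MvPolynomial (Fin (n + 1)) K) :
    monCoeff (monIndex i m) v = (v i).coeff m := rfl

lemma mem_degPiece {e : ℤ} {g : MvPolynomial (Fin (n + 1)) K} :
    g ∈ degPiece K n e ↔ ∀ m, g.coeff m ≠ 0 → (m.degree : ℤ) = e := by
  unfold degPiece
  split_ifs with h
  · rw [MvPolynomial.mem_homogeneousSubmodule]
    simp only [MvPolynomial.IsHomogeneous, MvPolynomial.IsWeightedHomogeneous]
    refine forall_congr' fun m => imp_congr_right fun _ => ?_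
    have hw : Finsupp.weight (1 : Fin (n + 1) → ℕ) m = m.degree :=
      (DFunLike.congr_fun Finsupp.degree_eq_weight_one m).symm
    rw [hw]
    omega
  · rw [Submodule.mem_bot]
    constructor
    · rintro rfl m hm
      simp at hm
    · intro hg
      ext m
      by_contra hm
      have := hg m (by simpa using hm)
      omega

lemma mem_freeDegPiece {f : Fin r → ℤ} {d : ℤ} {v : Fin r → MvPolynomial (Fin (n + 1)) K} :
    v ∈ freeDegPiece K n r f d ↔ ∀ i m, (v i).coeff m ≠ 0 → (m.degree : ℤ) + f i = d := by
  simp only [freeDegPiece, Submodule.mem_pi, Set.mem_univ, true_imp_iff, mem_degPiece]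
  refine forall_congr' fun i => forall_congr' fun m => imp_congr_right fun _ => ?_
  omega

lemma finite_setOf_degree_add_eq (n : ℕ) (f : Fin r → ℤ) (d : ℤ) :
    {j : MonIndex n r | ((ofLex (ofLex j).2).degree : ℤ) + f (ofLex j).1 = d}.Finite := by
  have h : (⋃ i : Fin r, monIndex i ''
      {m : Fin (n + 1) →₀ ℕ | m.degree ≤ (d - f i).toNat}).Finite :=
    Set.finite_iUnion fun i => (Finsupp.finite_of_degree_le _).image _
  refine h.subset fun j (hj : _ + _ = d) => Set.mem_iUnion.2 ⟨(ofLex j).1, _, ?_, rfl⟩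
  change (ofLex (ofLex j).2).degree ≤ _
  omega

/-- The indices of the monomials of degree `d` of the free module. -/
noncomputable def degIndices (n : ℕ) (f : Fin r → ℤ) (d : ℤ) : Finset (MonIndex n r) :=
  (finite_setOf_degree_add_eq n f d).toFinset

lemma monIndex_mem_degIndices {f : Fin r → ℤ} {d : ℤ} {i : Fin r} {m : Fin (n + 1) →₀ ℕ} :
    monIndex i m ∈ degIndices n f d ↔ (m.degree : ℤ) + f i = d :=
  (finite_setOf_degree_add_eq n f d).mem_toFinset

lemma card_leadIndices_of_le_freeDegPiece {f : Fin r → ℤ} {d : ℤ}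
    {V : Submodule K (Fin r → MvPolynomial (Fin (n + 1)) K)} (hV : V ≤ freeDegPiece K n r f d) :
    (leadIndices monCoeff (degIndices n f d) V).card = Module.finrank K V := by
  refine card_leadIndices_eq_finrank _ _ _ (fun v hv j hj => ?_) (fun v _ h0 => ?_)
  · obtain ⟨i, m, rfl⟩ := exists_eq_monIndex j
    exact monIndex_mem_degIndices.2 (mem_freeDegPiece.1 (hV hv) i m hj)
  · funext i
    ext m
    exact h0 (monIndex i m)

lemma leadIndices_freeDegPiece (f : Fin r → ℤ) (d : ℤ) :
    leadIndices monCoeff (degIndices n f d) (freeDegPiece K n r f d) = degIndices n f d := by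
  ext j
  rw [mem_leadIndices, and_iff_left_iff_imp]
  obtain ⟨i, m, rfl⟩ := exists_eq_monIndex j
  intro hj
  rw [monIndex_mem_degIndices] at hj
  have hcoeff : ∀ i' m', ((Pi.single i (MvPolynomial.monomial m (1 : K)) :
      Fin r → MvPolynomial (Fin (n + 1)) K) i').coeff m' = if i' = i ∧ m = m' then 1 else 0 := by
    intro i' m'
    by_cases hi : i' = i
    · subst hi
      simp [MvPolynomial.coeff_monomial]
    · simp [hi]
  refine ⟨Pi.single i (MvPolynomial.monomial m 1), ?_, ?_, ?_⟩
  · rw [mem_freeDegPiece]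
    intro i' m' h
    rw [hcoeff] at h
    obtain ⟨rfl, rfl⟩ : i' = i ∧ m = m' := by
      by_contra h'
      exact h (if_neg h')
    exact hj
  · rw [monCoeff_monIndex, hcoeff]
    simp
  · intro j hlt
    obtain ⟨i', m', rfl⟩ := exists_eq_monIndex j
    rw [monCoeff_monIndex, hcoeff, if_neg]
    rintro ⟨rfl, rfl⟩
    exact lt_irrefl _ hlt

/-- The indices of the standard monomials of degree `d`: those that are not leading monomials of
members of `N`. -/
noncomputable def stdIndices (f : Fin r → ℤ)
    (N : Submodule (MvPolynomial (Fin (n + 1)) K) (Fin r → MvPolynomial (Fin (n + 1)) K))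
    (d : ℤ) : Finset (MonIndex n r) :=
  degIndices n f d \
    leadIndices monCoeff (degIndices n f d) (N.restrictScalars K ⊓ freeDegPiece K n r f d)

lemma hilbFn_eq_card_stdIndices (f : Fin r → ℤ)
    (N : Submodule (MvPolynomial (Fin (n + 1)) K) (Fin r → MvPolynomial (Fin (n + 1)) K))
    (d : ℤ) : hilbFn K n r f N d = (stdIndices f N d).card := by
  rw [hilbFn, stdIndices, Finset.card_sdiff_of_subset (leadIndices_subset _ _ _),
    card_leadIndices_of_le_freeDegPiece inf_le_right, ← card_leadIndices_of_le_freeDegPiece le_rfl,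
    leadIndices_freeDegPiece]

lemma mem_stdIndices_of_add_single_mem {f : Fin r → ℤ}
    {N : Submodule (MvPolynomial (Fin (n + 1)) K) (Fin r → MvPolynomial (Fin (n + 1)) K)}
    {d : ℤ} {i : Fin r} {m : Fin (n + 1) →₀ ℕ} {k : Fin (n + 1)}
    (h : monIndex i (m + Finsupp.single k 1) ∈ stdIndices f N (d + 1)) :
    monIndex i m ∈ stdIndices f N d := by
  rw [stdIndices, Finset.mem_sdiff, monIndex_mem_degIndices] at h ⊢
  obtain ⟨hdeg, hlead⟩ := h
  rw [map_add, Finsupp.degree_single] at hdeg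
  push_cast at hdeg
  refine ⟨by omega, fun hm => hlead ?_⟩
  obtain ⟨-, v, ⟨hvN, hvF⟩, hv0, hv⟩ := mem_leadIndices.1 hm
  have hvF := mem_freeDegPiece.1 hvF
  set x : MvPolynomial (Fin (n + 1)) K := MvPolynomial.X k
  have hcoeff : ∀ (i' : Fin r) (m' : Fin (n + 1) →₀ ℕ),
      ((x • v) i').coeff (m' + Finsupp.single k 1) = (v i').coeff m' := by
    intro i' m'
    rw [Pi.smul_apply, smul_eq_mul, add_comm m', MvPolynomial.coeff_X_mul]
  have hcoeff0 : ∀ (i' : Fin r) (m' : Fin (n + 1) →₀ ℕ), m' k = 0 →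
      ((x • v) i').coeff m' = 0 := by
    intro i' m' h0
    rw [Pi.smul_apply, smul_eq_mul, MvPolynomial.coeff_X_mul', if_neg (by simpa using h0)]
  have hsplit : ∀ m' : Fin (n + 1) →₀ ℕ, m' k ≠ 0 → ∃ m'', m' = m'' + Finsupp.single k 1 :=
    fun m' h0 => ⟨m' - Finsupp.single k 1, (tsub_add_cancel_of_le
      (Finsupp.single_le_iff.2 (Nat.one_le_iff_ne_zero.2 h0))).symm⟩
  refine mem_leadIndices.2 ⟨monIndex_mem_degIndices.2 ?_, x • v,
    ⟨N.smul_mem _ hvN, mem_freeDegPiece.2 fun i' m' h0 => ?_⟩, ?_, fun j hj => ?_⟩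
  · rw [map_add, Finsupp.degree_single]
    push_cast
    omega
  · obtain ⟨m'', rfl⟩ := hsplit m' fun h => h0 (hcoeff0 i' m' h)
    rw [hcoeff] at h0
    have := hvF i' m'' h0
    rw [map_add, Finsupp.degree_single]
    push_cast
    omega
  · rw [monCoeff_monIndex, hcoeff]
    exact hv0
  · obtain ⟨i', m', rfl⟩ := exists_eq_monIndex j
    rw [monCoeff_monIndex]
    by_cases h0 : m' k = 0
    · exact hcoeff0 i' m' h0
    · obtain ⟨m'', rfl⟩ := hsplit m' h0
      rw [hcoeff]
      exact hv _ (monIndex_lt_of_add_lt hj)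

/-- The monomial `x^m e_i` encoded as a monomial in variables indexed by `ℕ`: the first `r`
variables stand for the basis vectors. -/
noncomputable def encodeMon (j : MonIndex n r) : ℕ →₀ ℕ :=
  Finsupp.single ((ofLex j).1 : ℕ) 1
    + (ofLex (ofLex j).2).mapDomain (fun k : Fin (n + 1) => r + (k : ℕ))

lemma encodeMon_monIndex (i : Fin r) (m : Fin (n + 1) →₀ ℕ) :
    encodeMon (monIndex i m)
      = Finsupp.single (i : ℕ) 1 + m.mapDomain (fun k : Fin (n + 1) => r + (k : ℕ)) := rfl

lemma add_val_injective (n r : ℕ) : Function.Injective fun k : Fin (n + 1) => r + (k : ℕ) :=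
  fun _ _ h => Fin.ext (Nat.add_left_cancel h)

lemma encodeMon_apply_lt (i : Fin r) (m : Fin (n + 1) →₀ ℕ) {k : ℕ} (hk : k < r) :
    encodeMon (monIndex i m) k = if (i : ℕ) = k then 1 else 0 := by
  rw [encodeMon_monIndex, Finsupp.add_apply, Finsupp.mapDomain_of_notMem_range,
    Finsupp.single_apply, add_zero]
  rintro ⟨k', h⟩
  simp only at h
  omega

lemma encodeMon_apply_add (i : Fin r) (m : Fin (n + 1) →₀ ℕ) (k : Fin (n + 1)) :
    encodeMon (monIndex i m) (r + k) = m k := by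
  rw [encodeMon_monIndex, Finsupp.add_apply, Finsupp.single_eq_of_ne (by omega), zero_add]
  exact Finsupp.mapDomain_apply (add_val_injective n r) m k

lemma encodeMon_injective : Function.Injective (encodeMon (n := n) (r := r)) := by
  intro j j' h
  obtain ⟨i, m, rfl⟩ := exists_eq_monIndex j
  obtain ⟨i', m', rfl⟩ := exists_eq_monIndex j'
  have hi : i = i' := by
    have := DFunLike.congr_fun h (i : ℕ)
    rw [encodeMon_apply_lt _ _ i.2, encodeMon_apply_lt _ _ i.2, if_pos rfl] at this
    by_contra hne
    rw [if_neg fun h => hne (Fin.ext h.symm)] at this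
    omega
  have hm : m = m' := by
    ext k
    rw [← encodeMon_apply_add i m, h, encodeMon_apply_add]
  rw [hi, hm]

lemma tailDegree_encodeMon (i : Fin r) (m : Fin (n + 1) →₀ ℕ) :
    tailDegree r (encodeMon (monIndex i m)) = m.degree := by
  have h1 : tailDegree r (Finsupp.single (i : ℕ) 1) = 0 := by
    simp [tailDegree, Finsupp.weight_single]
  rw [encodeMon_monIndex, map_add, h1, zero_add]
  induction m using Finsupp.induction_linear with
  | zero => simp
  | add a b ha hb => rw [Finsupp.mapDomain_add, map_add, map_add, ha, hb]
  | single k c =>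
    rw [Finsupp.mapDomain_single, tailDegree_single (Nat.le_add_right _ _), Finsupp.degree_single]

lemma encodeMon_add_single (i : Fin r) (m : Fin (n + 1) →₀ ℕ) (k : Fin (n + 1)) :
    encodeMon (monIndex i (m + Finsupp.single k 1))
      = encodeMon (monIndex i m) + Finsupp.single (r + (k : ℕ)) 1 := by
  rw [encodeMon_monIndex, encodeMon_monIndex, Finsupp.mapDomain_add, Finsupp.mapDomain_single,
    add_assoc]

lemma exists_of_encodeMon_eq {i : Fin r} {m : Fin (n + 1) →₀ ℕ} {k : ℕ} {u : ℕ →₀ ℕ} (hk : r ≤ k)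
    (h : encodeMon (monIndex i m) = u + Finsupp.single k 1) :
    ∃ m' k', m = m' + Finsupp.single k' 1 ∧ u = encodeMon (monIndex i m') := by
  have hne : encodeMon (monIndex i m) k ≠ 0 := by simp [h]
  obtain ⟨k', rfl⟩ : ∃ k' : Fin (n + 1), r + (k' : ℕ) = k := by
    by_contra hex
    refine hne ?_
    rw [encodeMon_monIndex, Finsupp.add_apply, Finsupp.single_eq_of_ne (by omega),
      Finsupp.mapDomain_of_notMem_range _ _ fun ⟨k', hk'⟩ => hex ⟨k', hk'⟩,
      add_zero]
  rw [encodeMon_apply_add] at hne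
  have hm : m - Finsupp.single k' 1 + Finsupp.single k' 1 = m :=
    tsub_add_cancel_of_le (Finsupp.single_le_iff.2 (Nat.one_le_iff_ne_zero.2 hne))
  refine ⟨_, k', hm.symm, ?_⟩
  rw [← hm, encodeMon_add_single] at h
  exact (add_right_cancel h).symm

lemma containsShadow_image_stdIndices (f : Fin r → ℤ)
    (N : Submodule (MvPolynomial (Fin (n + 1)) K) (Fin r → MvPolynomial (Fin (n + 1)) K))
    (d : ℤ) : ContainsShadow r ((stdIndices f N d).image encodeMon)
      ((stdIndices f N (d + 1)).image encodeMon) := by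
  intro k u hk hu
  obtain ⟨j, hj, hju⟩ := Finset.mem_image.1 hu
  obtain ⟨i, m, rfl⟩ := exists_eq_monIndex j
  obtain ⟨m', k', rfl, rfl⟩ := exists_of_encodeMon_eq hk hju
  exact Finset.mem_image_of_mem _ (mem_stdIndices_of_add_single_mem hj)

lemma le_tailDegree_of_mem_image_stdIndices {f : Fin r → ℤ}
    {N : Submodule (MvPolynomial (Fin (n + 1)) K) (Fin r → MvPolynomial (Fin (n + 1)) K)}
    {d l : ℤ} (hfl : ∀ i, f i ≤ l) {u : ℕ →₀ ℕ} (hu : u ∈ (stdIndices f N d).image encodeMon) :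
    d - l ≤ tailDegree r u := by
  obtain ⟨j, hj, rfl⟩ := Finset.mem_image.1 hu
  obtain ⟨i, m, rfl⟩ := exists_eq_monIndex j
  have := monIndex_mem_degIndices.1 (Finset.mem_sdiff.1 hj).1
  have := hfl i
  rw [tailDegree_encodeMon]
  omega

end FreeModule

/-- **Gasharov's bound.** Let `S = k[x_0, …, x_n]`, `F = S e_1 ⊕ ⋯ ⊕ S e_r` a
free graded module whose generators have degrees `f i ≤ l`, `N` a graded submodule of `F`
(i.e. generated by homogeneous elements), and `M = F/N`. Then for all integers `p ≥ 0` and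
`d ≥ p + l + 1` one has `H(M, d+1) ≤ H(M, d)^{⟨d - l - p⟩}`. -/
theorem gasharov_macaulay_bound (K : Type) [Field K] (n r : ℕ)
    (f : Fin r → ℤ) (l : ℤ) (hfl : ∀ i, f i ≤ l)
    (N : Submodule (MvPolynomial (Fin (n+1)) K) (Fin r → MvPolynomial (Fin (n+1)) K))
    (hN : ∃ G : Set (Fin r → MvPolynomial (Fin (n+1)) K),
      N = Submodule.span (MvPolynomial (Fin (n+1)) K) G ∧
        ∀ g ∈ G, ∃ m : ℤ, g ∈ freeDegPiece K n r f m)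
    (p d : ℤ) (hp : 0 ≤ p) (hd : p + l + 1 ≤ d) :
    hilbFn K n r f N (d + 1) ≤ macaulayTransform (d - l - p).toNat (hilbFn K n r f N d) := by
  obtain ⟨t, ht⟩ : ∃ t, (d - l - p).toNat = t + 1 := ⟨(d - l - p).toNat - 1, by omega⟩
  rw [hilbFn_eq_card_stdIndices, hilbFn_eq_card_stdIndices, ht,
    ← Finset.card_image_of_injective _ encodeMon_injective,
    ← Finset.card_image_of_injective (stdIndices f N d) encodeMon_injective]
  refine card_le_macaulayTransform (containsShadow_image_stdIndices f N d) (fun u hu => ?_)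
    (fun u hu => ?_)
  · have := le_tailDegree_of_mem_image_stdIndices hfl hu
    omega
  · have := le_tailDegree_of_mem_image_stdIndices hfl hu
    omega
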